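/- Elimination of a fixed school: for any k ∈ C and X ⊆ C \ {k}, v(X ∪ {k}; t) = v(X; t̄) + f_k t_k, where t̄_j = (1 − f_k) t_j if t_j ≤ t_k and t̄_j = t_j − f_k t_k if t_j > t_k (and t̄_0 = 0). -/

import Mathlib

noncomputable def val (f t : ℕ → ℝ) (X : Finset ℕ) : ℝ :=
  ∑ j ∈ X, f j * t j * ∏ i ∈ X.filter (fun i => j < i), (1 - f i)

/-- The order-dual form of `Finset.prod_one_sub_ordered`: the probabilities that `j` is the largest
index that succeeds add up to the probability that some index succeeds. -/
lemma sum_mul_prod_filter_lt_one_sub {ι R : Type*} [LinearOrder ι] [CommRing R]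
    (s : Finset ι) (f : ι → R) :
    ∑ j ∈ s, f j * ∏ i ∈ s.filter (fun i => j < i), (1 - f i) = 1 - ∏ i ∈ s, (1 - f i) := by
  have h := Finset.prod_one_sub_ordered (ι := ιᵒᵈ) s f
  exact eq_sub_of_add_eq' (eq_sub_iff_add_eq.mp h)

/-- elimination of a fixed school k. -/
theorem stmt_3 (m : ℕ) (f t : ℕ → ℝ) (k : ℕ) (X : Finset ℕ)
    (hk : k ∈ Finset.Icc 1 m) (hX : X ⊆ (Finset.Icc 1 m).erase k)
    (hf : ∀ j, 0 < f j ∧ f j ≤ 1) (ht0 : t 0 = 0) (hmono : Monotone t) :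
    val f t (insert k X)
      = val f (fun j => if t j ≤ t k then (1 - f k) * t j else t j - f k * t k) X
        + f k * t k := by
  have hkX : k ∉ X := fun h => Finset.notMem_erase k _ (hX h)
  have htail := sum_mul_prod_filter_lt_one_sub (X.filter (fun i => k < i)) f
  have hsum : ∑ j ∈ X, f j * t j * ∏ i ∈ (insert k X).filter (fun i => j < i), (1 - f i)
      = val f (fun j => if t j ≤ t k then (1 - f k) * t j else t j - f k * t k) X
        + f k * t k * ∑ j ∈ X.filter (fun i => k < i),
          f j * ∏ i ∈ (X.filter (fun i => k < i)).filter (fun i => j < i), (1 - f i) := by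
    rw [val, Finset.mul_sum, Finset.sum_filter, ← Finset.sum_add_distrib]
    refine Finset.sum_congr rfl fun j hj => ?_
    rcases lt_or_gt_of_ne (ne_of_mem_of_not_mem hj hkX) with hjk | hkj
    · rw [Finset.filter_insert, if_pos hjk, Finset.prod_insert (by simp [hkX]),
        if_pos (hmono hjk.le), if_neg hjk.not_gt]
      ring
    · have hfilter : (X.filter (fun i => k < i)).filter (fun i => j < i)
          = X.filter (fun i => j < i) := by
        rw [Finset.filter_filter]
        exact Finset.filter_congr fun i _ => ⟨And.right, fun h => ⟨hkj.trans h, h⟩⟩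
      rw [Finset.filter_insert, if_neg hkj.not_gt, if_pos hkj, hfilter]
      split_ifs with h
      · rw [le_antisymm h (hmono hkj.le)]
        ring
      · ring
  rw [htail] at hsum
  rw [val, Finset.sum_insert hkX, hsum, Finset.filter_insert, if_neg (lt_irrefl k)]
  ring
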